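/- arXiv:1807.10278 — 3 statements merged into one kernel-verified Lean document; each statement's English description precedes it below -/
import Mathlib

section
/- Let y ∈ ℝ^{I₁I₂N}, let X ∈ ℝ^{N×p}, and let Σ₁ ∈ ℝ^{I₁×I₁}, Σ₂ ∈ ℝ^{I₂×I₂}, Σ₃ ∈ ℝ^{N×N} be symmetric positive definite with XᵀΣ₃⁻¹X invertible. Then the vector a* = (((XᵀΣ₃⁻¹X)⁻¹XᵀΣ₃⁻¹) ⊗ I_{I₂} ⊗ I_{I₁}) y is a global minimizer of the generalized least squares objective f(a) = (y − (X ⊗ I_{I₂} ⊗ I_{I₁})a)ᵀ (Σ₃ ⊗ Σ₂ ⊗ Σ₁)⁻¹ (y − (X ⊗ I_{I₂} ⊗ I_{I₁})a) over a ∈ ℝ^{I₁I₂p}. -/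
open Matrix
open scoped Kronecker

/-- The generalized least squares objective
`f(a) = (y − (X ⊗ I ⊗ I)a)ᵀ (S₃ ⊗ S₂ ⊗ S₁)⁻¹ (y − (X ⊗ I ⊗ I)a)`. -/
noncomputable def glsObjNoBasis {I₁ I₂ N p : ℕ}
    (X : Matrix (Fin N) (Fin p) ℝ)
    (S₁ : Matrix (Fin I₁) (Fin I₁) ℝ) (S₂ : Matrix (Fin I₂) (Fin I₂) ℝ)
    (S₃ : Matrix (Fin N) (Fin N) ℝ)
    (y : Matrix (Fin N × Fin I₂ × Fin I₁) (Fin 1) ℝ)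
    (a : Matrix (Fin p × Fin I₂ × Fin I₁) (Fin 1) ℝ) : ℝ :=
  ((y - (X ⊗ₖ ((1 : Matrix (Fin I₂) (Fin I₂) ℝ) ⊗ₖ (1 : Matrix (Fin I₁) (Fin I₁) ℝ))) * a)ᵀ *
      (S₃ ⊗ₖ (S₂ ⊗ₖ S₁))⁻¹ *
      (y - (X ⊗ₖ ((1 : Matrix (Fin I₂) (Fin I₂) ℝ) ⊗ₖ (1 : Matrix (Fin I₁) (Fin I₁) ℝ))) * a)) 0 0

theorem gls_aux {m n : Type*} [Fintype m] [Fintype n] [DecidableEq m]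
    (W : Matrix m m ℝ) (hW : W.PosSemidef) (K : Matrix m n ℝ) (P : Matrix n m ℝ)
    (h : Kᵀ * W * K * P = Kᵀ * W) (y : Matrix m (Fin 1) ℝ) (a : Matrix n (Fin 1) ℝ) :
    ((y - K * (P * y))ᵀ * W * (y - K * (P * y))) 0 0
      ≤ ((y - K * a)ᵀ * W * (y - K * a)) 0 0 := by
  have hWt : Wᵀ = W := by
    have := hW.1
    rwa [Matrix.IsHermitian, conjTranspose_eq_transpose_of_trivial] at this
  set r := y - K * (P * y) with hr
  set d := P * y - a with hd
  have e : y - K * a = r + K * d := by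
    rw [hr, hd, Matrix.mul_sub]; abel
  have h1 : Kᵀ * W * r = 0 := by
    rw [hr, Matrix.mul_sub, ← Matrix.mul_assoc, ← Matrix.mul_assoc, h, sub_self]
  have h2 : rᵀ * W * K = 0 := by
    have := congrArg transpose h1
    simpa [transpose_mul, hWt, Matrix.mul_assoc] using this
  have h3 : (r + K * d)ᵀ * W * (r + K * d) = rᵀ * W * r + (K * d)ᵀ * W * (K * d) := by
    have e1 : rᵀ * W * (K * d) = 0 := by rw [← Matrix.mul_assoc, h2, Matrix.zero_mul]
    have e2 : (K * d)ᵀ * W * r = 0 := by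
      rw [transpose_mul, Matrix.mul_assoc, Matrix.mul_assoc, ← Matrix.mul_assoc Kᵀ, h1,
        Matrix.mul_zero]
    rw [transpose_add, Matrix.add_mul, Matrix.add_mul, Matrix.mul_add, Matrix.mul_add, e1, e2]
    abel
  have h4 : 0 ≤ ((K * d)ᵀ * W * (K * d)) 0 0 := by
    have := (hW.conjTranspose_mul_mul_same (K * d)).diag_nonneg (i := 0)
    rwa [conjTranspose_eq_transpose_of_trivial] at this
  rw [e, h3, Matrix.add_apply]
  linarith

/-- `a* = (((XᵀS₃⁻¹X)⁻¹XᵀS₃⁻¹) ⊗ I ⊗ I) y` is a global minimizer of the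
generalized least squares objective. -/
theorem stmt_0 (I₁ I₂ N p : ℕ)
    (y : Matrix (Fin N × Fin I₂ × Fin I₁) (Fin 1) ℝ)
    (X : Matrix (Fin N) (Fin p) ℝ)
    (S₁ : Matrix (Fin I₁) (Fin I₁) ℝ) (S₂ : Matrix (Fin I₂) (Fin I₂) ℝ)
    (S₃ : Matrix (Fin N) (Fin N) ℝ)
    (hS₁ : S₁.PosDef) (hS₂ : S₂.PosDef) (hS₃ : S₃.PosDef)
    (hX : IsUnit (Xᵀ * S₃⁻¹ * X)) :
    ∀ a : Matrix (Fin p × Fin I₂ × Fin I₁) (Fin 1) ℝ,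
      glsObjNoBasis X S₁ S₂ S₃ y
          (((((Xᵀ * S₃⁻¹ * X)⁻¹ * Xᵀ * S₃⁻¹)) ⊗ₖ
              ((1 : Matrix (Fin I₂) (Fin I₂) ℝ) ⊗ₖ (1 : Matrix (Fin I₁) (Fin I₁) ℝ))) * y)
        ≤ glsObjNoBasis X S₁ S₂ S₃ y a := by
  intro a
  unfold glsObjNoBasis
  refine gls_aux _ (hS₃.kronecker (hS₂.kronecker hS₁)).inv.posSemidef _ _ ?_ y a
  have hdet := (Matrix.isUnit_iff_isUnit_det _).1 hX
  rw [inv_kronecker, one_kronecker_one, ← kroneckerMap_transpose, transpose_one]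
  simp only [← mul_kronecker_mul, Matrix.mul_one, Matrix.one_mul]
  congr 1
  rw [← Matrix.mul_assoc, ← Matrix.mul_assoc, Matrix.mul_nonsing_inv _ hdet, Matrix.one_mul]
end

section
/- Let y ∈ ℝ^{I₁I₂N}, X ∈ ℝ^{N×p}, U⁽¹⁾ ∈ ℝ^{I₁×P₁}, U⁽²⁾ ∈ ℝ^{I₂×P₂}, let Σ₁, Σ₂, Σ₃ be symmetric positive definite with XᵀΣ₃⁻¹X invertible, let P₁ ∈ ℝ^{P₁×P₁} and P₂ ∈ ℝ^{P₂×P₂} be symmetric positive semidefinite, and let λ > 0. Assume U⁽¹⁾ᵀΣ₁⁻¹U⁽¹⁾ + λP₁ and U⁽²⁾ᵀΣ₂⁻¹U⁽²⁾ + λP₂ are invertible. Define the penalty P(β) = βᵀ [(XᵀΣ₃⁻¹X) ⊗ (λ P₂ ⊗ U⁽¹⁾ᵀΣ₁⁻¹U⁽¹⁾ + λ U⁽²⁾ᵀΣ₂⁻¹U⁽²⁾ ⊗ P₁ + λ² P₂ ⊗ P₁)] β. Then β* = ((XᵀΣ₃⁻¹X)⁻¹XᵀΣ₃⁻¹ ⊗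 (U⁽²⁾ᵀΣ₂⁻¹U⁽²⁾ + λP₂)⁻¹U⁽²⁾ᵀΣ₂⁻¹ ⊗ (U⁽¹⁾ᵀΣ₁⁻¹U⁽¹⁾ + λP₁)⁻¹U⁽¹⁾ᵀΣ₁⁻¹) y is a global minimizer of the penalized objective (y − (X ⊗ U⁽²⁾ ⊗ U⁽¹⁾)β)ᵀ (Σ₃ ⊗ Σ₂ ⊗ Σ₁)⁻¹ (y − (X ⊗ U⁽²⁾ ⊗ U⁽¹⁾)β) + P(β) over β ∈ ℝ^{P₁P₂p}. -/
open Matrix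
open scoped Kronecker

/-- The generalized least squares part of the objective:
`(y − (X ⊗ U² ⊗ U¹)β)ᵀ (Σ₃ ⊗ Σ₂ ⊗ Σ₁)⁻¹ (y − (X ⊗ U² ⊗ U¹)β)`. -/
noncomputable def glsPart {I₁ I₂ N p P₁ P₂ : ℕ}
    (X : Matrix (Fin N) (Fin p) ℝ)
    (U₁ : Matrix (Fin I₁) (Fin P₁) ℝ) (U₂ : Matrix (Fin I₂) (Fin P₂) ℝ)
    (S₁ : Matrix (Fin I₁) (Fin I₁) ℝ) (S₂ : Matrix (Fin I₂) (Fin I₂) ℝ)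
    (S₃ : Matrix (Fin N) (Fin N) ℝ)
    (y : Matrix (Fin N × Fin I₂ × Fin I₁) (Fin 1) ℝ)
    (β : Matrix (Fin p × Fin P₂ × Fin P₁) (Fin 1) ℝ) : ℝ :=
  ((y - (X ⊗ₖ (U₂ ⊗ₖ U₁)) * β)ᵀ * (S₃ ⊗ₖ (S₂ ⊗ₖ S₁))⁻¹ *
      (y - (X ⊗ₖ (U₂ ⊗ₖ U₁)) * β)) 0 0

/-- The penalty term
`P(β) = βᵀ [(XᵀΣ₃⁻¹X) ⊗ (λP₂ ⊗ U¹ᵀΣ₁⁻¹U¹ + λ U²ᵀΣ₂⁻¹U² ⊗ P₁ + λ²P₂ ⊗ P₁)] β`. -/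
noncomputable def penaltyTerm {I₁ I₂ N p P₁ P₂ : ℕ}
    (X : Matrix (Fin N) (Fin p) ℝ)
    (U₁ : Matrix (Fin I₁) (Fin P₁) ℝ) (U₂ : Matrix (Fin I₂) (Fin P₂) ℝ)
    (S₁ : Matrix (Fin I₁) (Fin I₁) ℝ) (S₂ : Matrix (Fin I₂) (Fin I₂) ℝ)
    (S₃ : Matrix (Fin N) (Fin N) ℝ)
    (Pm₁ : Matrix (Fin P₁) (Fin P₁) ℝ) (Pm₂ : Matrix (Fin P₂) (Fin P₂) ℝ)
    (lam : ℝ)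
    (β : Matrix (Fin p × Fin P₂ × Fin P₁) (Fin 1) ℝ) : ℝ :=
  (βᵀ * ((Xᵀ * S₃⁻¹ * X) ⊗ₖ
        (lam • (Pm₂ ⊗ₖ (U₁ᵀ * S₁⁻¹ * U₁)) + lam • ((U₂ᵀ * S₂⁻¹ * U₂) ⊗ₖ Pm₁) +
          lam ^ 2 • (Pm₂ ⊗ₖ Pm₁))) * β) 0 0

lemma quad_min_aux {m n : Type*} [Fintype m] [Fintype n]
    (A : Matrix m n ℝ) (W : Matrix m m ℝ) (Q M : Matrix n n ℝ)
    (y : Matrix m (Fin 1) ℝ) (b β : Matrix n (Fin 1) ℝ)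
    (hW : Wᵀ = W) (hM : M = Aᵀ * W * A + Q) (hMp : M.PosSemidef)
    (hb : M * b = Aᵀ * W * y) :
    ((y - A * b)ᵀ * W * (y - A * b)) 0 0 + (bᵀ * Q * b) 0 0
      ≤ ((y - A * β)ᵀ * W * (y - A * β)) 0 0 + (βᵀ * Q * β) 0 0 := by
  have hMt : Mᵀ = M := by simpa using hMp.1.eq
  have hbt : bᵀ * M = yᵀ * W * A := by
    have := congrArg transpose hb
    simpa [transpose_mul, hMt, hW, Matrix.mul_assoc] using this
  have hQ : Q = M - Aᵀ * W * A := by rw [hM]; abel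
  have key : ∀ c : Matrix n (Fin 1) ℝ,
      (y - A * c)ᵀ * W * (y - A * c) + cᵀ * Q * c
        = yᵀ * W * y - bᵀ * M * c - cᵀ * (M * b) + cᵀ * M * c := by
    intro c
    rw [hbt, hb, hQ]
    simp only [transpose_sub, transpose_mul, Matrix.mul_sub, Matrix.sub_mul, Matrix.mul_assoc]
    abel
  have hd : (y - A * β)ᵀ * W * (y - A * β) + βᵀ * Q * β
      = ((y - A * b)ᵀ * W * (y - A * b) + bᵀ * Q * b) + (β - b)ᵀ * M * (β - b) := by
    rw [key, key]
    simp only [transpose_sub, Matrix.mul_sub, Matrix.sub_mul, Matrix.mul_assoc]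
    abel
  have hp : 0 ≤ ((β - b)ᵀ * M * (β - b)) 0 0 := by
    have := (hMp.conjTranspose_mul_mul_same (β - b)).diag_nonneg (i := 0)
    simpa using this
  have := congrFun (congrFun hd 0) 0
  simp only [Matrix.add_apply] at this
  linarith

/-- Proposition 2: the closed-form solution of the regularized tensor
regression is a global minimizer of the penalized objective. -/
theorem stmt_2 (I₁ I₂ N p P₁ P₂ : ℕ)
    (y : Matrix (Fin N × Fin I₂ × Fin I₁) (Fin 1) ℝ)
    (X : Matrix (Fin N) (Fin p) ℝ)
    (U₁ : Matrix (Fin I₁) (Fin P₁) ℝ) (U₂ : Matrix (Fin I₂) (Fin P₂) ℝ)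
    (S₁ : Matrix (Fin I₁) (Fin I₁) ℝ) (S₂ : Matrix (Fin I₂) (Fin I₂) ℝ)
    (S₃ : Matrix (Fin N) (Fin N) ℝ)
    (hS₁ : S₁.PosDef) (hS₂ : S₂.PosDef) (hS₃ : S₃.PosDef)
    (hX : IsUnit (Xᵀ * S₃⁻¹ * X))
    (Pm₁ : Matrix (Fin P₁) (Fin P₁) ℝ) (Pm₂ : Matrix (Fin P₂) (Fin P₂) ℝ)
    (hPm₁ : Pm₁.PosSemidef) (hPm₂ : Pm₂.PosSemidef)
    (lam : ℝ) (hlam : 0 < lam)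
    (hU₁ : IsUnit (U₁ᵀ * S₁⁻¹ * U₁ + lam • Pm₁))
    (hU₂ : IsUnit (U₂ᵀ * S₂⁻¹ * U₂ + lam • Pm₂)) :
    ∀ β : Matrix (Fin p × Fin P₂ × Fin P₁) (Fin 1) ℝ,
      glsPart X U₁ U₂ S₁ S₂ S₃ y
            ((((Xᵀ * S₃⁻¹ * X)⁻¹ * Xᵀ * S₃⁻¹) ⊗ₖ
                (((U₂ᵀ * S₂⁻¹ * U₂ + lam • Pm₂)⁻¹ * U₂ᵀ * S₂⁻¹) ⊗ₖ
                  ((U₁ᵀ * S₁⁻¹ * U₁ + lam • Pm₁)⁻¹ * U₁ᵀ * S₁⁻¹))) * y) +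
          penaltyTerm X U₁ U₂ S₁ S₂ S₃ Pm₁ Pm₂ lam
            ((((Xᵀ * S₃⁻¹ * X)⁻¹ * Xᵀ * S₃⁻¹) ⊗ₖ
                (((U₂ᵀ * S₂⁻¹ * U₂ + lam • Pm₂)⁻¹ * U₂ᵀ * S₂⁻¹) ⊗ₖ
                  ((U₁ᵀ * S₁⁻¹ * U₁ + lam • Pm₁)⁻¹ * U₁ᵀ * S₁⁻¹))) * y)
        ≤ glsPart X U₁ U₂ S₁ S₂ S₃ y β + penaltyTerm X U₁ U₂ S₁ S₂ S₃ Pm₁ Pm₂ lam β := by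
  intro β
  unfold glsPart penaltyTerm
  have hG₁ : (U₁ᵀ * S₁⁻¹ * U₁).PosSemidef := by
    simpa using hS₁.inv.posSemidef.conjTranspose_mul_mul_same U₁
  have hG₂ : (U₂ᵀ * S₂⁻¹ * U₂).PosSemidef := by
    simpa using hS₂.inv.posSemidef.conjTranspose_mul_mul_same U₂
  have hG₃ : (Xᵀ * S₃⁻¹ * X).PosSemidef := by
    simpa using hS₃.inv.posSemidef.conjTranspose_mul_mul_same X
  have hWp : (S₃ ⊗ₖ (S₂ ⊗ₖ S₁))⁻¹.PosDef := (hS₃.kronecker (hS₂.kronecker hS₁)).inv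
  have hWe : (S₃ ⊗ₖ (S₂ ⊗ₖ S₁))⁻¹ = S₃⁻¹ ⊗ₖ (S₂⁻¹ ⊗ₖ S₁⁻¹) := by
    rw [inv_kronecker, inv_kronecker]
  have hAt : (X ⊗ₖ (U₂ ⊗ₖ U₁))ᵀ = Xᵀ ⊗ₖ (U₂ᵀ ⊗ₖ U₁ᵀ) := by
    simp only [kroneckerMap_transpose]
  refine quad_min_aux _ _ _ ((Xᵀ * S₃⁻¹ * X) ⊗ₖ
    ((U₂ᵀ * S₂⁻¹ * U₂ + lam • Pm₂) ⊗ₖ (U₁ᵀ * S₁⁻¹ * U₁ + lam • Pm₁))) y _ β ?_ ?_ ?_ ?_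
  · simpa using hWp.1.eq
  · rw [hWe, hAt]
    simp only [← mul_kronecker_mul]
    rw [← kronecker_add]
    congr 1
    simp only [add_kronecker, kronecker_add, smul_kronecker, kronecker_smul, smul_add, smul_smul, pow_two]
    abel
  · exact hG₃.kronecker ((hG₂.add (hPm₂.smul hlam.le)).kronecker (hG₁.add (hPm₁.smul hlam.le)))
  · rw [hWe, hAt, ← Matrix.mul_assoc]
    simp only [← mul_kronecker_mul, ← Matrix.mul_assoc]
    rw [Matrix.mul_nonsing_inv _ ((Matrix.isUnit_iff_isUnit_det _).1 hX),
      Matrix.mul_nonsing_inv _ ((Matrix.isUnit_iff_isUnit_det _).1 hU₁),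
      Matrix.mul_nonsing_inv _ ((Matrix.isUnit_iff_isUnit_det _).1 hU₂)]
    simp only [Matrix.one_mul]
end

section
/- Let y ∈ ℝ^{I₁I₂N}, X ∈ ℝ^{N×p}, let Σ₁, Σ₂, Σ₃ be symmetric positive definite with XᵀΣ₃⁻¹X invertible, and suppose U⁽¹⁾ ∈ ℝ^{I₁×P₁} and U⁽²⁾ ∈ ℝ^{I₂×P₂} satisfy U⁽¹⁾ᵀΣ₁⁻¹U⁽¹⁾ = I_{P₁} and U⁽²⁾ᵀΣ₂⁻¹U⁽²⁾ = I_{P₂}. Let X₃ be any matrix with X₃X₃ᵀ = Σ₃⁻¹X(XᵀΣ₃⁻¹X)⁻¹XᵀΣ₃⁻¹. Then the minimum over β ∈ ℝ^{P₁P₂p} of l(β) = (y − (X ⊗ U⁽²⁾ ⊗ U⁽¹⁾)β)ᵀ (Σ₃ ⊗ Σ₂ ⊗ Σ₁)⁻¹ (y − (X ⊗ U⁽²⁾ ⊗ U⁽¹⁾)β) equals yᵀ(Σ₃ ⊗ Σ₂ ⊗ Σ₁)⁻¹y − ‖(X₃ᵀ ⊗ U⁽²⁾ᵀΣ₂⁻¹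 ⊗ U⁽¹⁾ᵀΣ₁⁻¹) y‖². Consequently, minimizing the profiled objective over (U⁽¹⁾, U⁽²⁾) subject to the constraints U⁽ᵏ⁾ᵀΣₖ⁻¹U⁽ᵏ⁾ = I is equivalent to maximizing ‖(X₃ᵀ ⊗ U⁽²⁾ᵀΣ₂⁻¹ ⊗ U⁽¹⁾ᵀΣ₁⁻¹) y‖² subject to the same constraints. -/
open Matrix
open scoped Kronecker

/-- The generalized least squares objective with basis matrices `U¹, U²`. -/
noncomputable def glsObj {I₁ I₂ N p P₁ P₂ : ℕ}
    (X : Matrix (Fin N) (Fin p) ℝ)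
    (U₁ : Matrix (Fin I₁) (Fin P₁) ℝ) (U₂ : Matrix (Fin I₂) (Fin P₂) ℝ)
    (S₁ : Matrix (Fin I₁) (Fin I₁) ℝ) (S₂ : Matrix (Fin I₂) (Fin I₂) ℝ)
    (S₃ : Matrix (Fin N) (Fin N) ℝ)
    (y : Matrix (Fin N × Fin I₂ × Fin I₁) (Fin 1) ℝ)
    (β : Matrix (Fin p × Fin P₂ × Fin P₁) (Fin 1) ℝ) : ℝ :=
  ((y - (X ⊗ₖ (U₂ ⊗ₖ U₁)) * β)ᵀ * (S₃ ⊗ₖ (S₂ ⊗ₖ S₁))⁻¹ *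
      (y - (X ⊗ₖ (U₂ ⊗ₖ U₁)) * β)) 0 0

/-- The squared Euclidean norm `‖(X₃ᵀ ⊗ U²ᵀΣ₂⁻¹ ⊗ U¹ᵀΣ₁⁻¹) y‖²` of the projected scores. -/
noncomputable def projScore {I₁ I₂ N q P₁ P₂ : ℕ}
    (X₃ : Matrix (Fin N) (Fin q) ℝ)
    (U₁ : Matrix (Fin I₁) (Fin P₁) ℝ) (U₂ : Matrix (Fin I₂) (Fin P₂) ℝ)
    (S₁ : Matrix (Fin I₁) (Fin I₁) ℝ) (S₂ : Matrix (Fin I₂) (Fin I₂) ℝ)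
    (y : Matrix (Fin N × Fin I₂ × Fin I₁) (Fin 1) ℝ) : ℝ :=
  (((X₃ᵀ ⊗ₖ ((U₂ᵀ * S₂⁻¹) ⊗ₖ (U₁ᵀ * S₁⁻¹))) * y)ᵀ *
      ((X₃ᵀ ⊗ₖ ((U₂ᵀ * S₂⁻¹) ⊗ₖ (U₁ᵀ * S₁⁻¹))) * y)) 0 0

theorem gls_aux_s6 {m n : Type*} [Fintype m] [Fintype n] [DecidableEq m] [DecidableEq n]
    (W : Matrix m m ℝ) (hW : W.PosDef) (A : Matrix m n ℝ) (G : Matrix n n ℝ)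
    (hG : (Aᵀ * W * A) * G = 1) (hGt : Gᵀ = G) (y : Matrix m (Fin 1) ℝ) :
    IsLeast (Set.range fun β : Matrix n (Fin 1) ℝ => ((y - A * β)ᵀ * W * (y - A * β)) 0 0)
      ((yᵀ * W * y) 0 0 - (yᵀ * (W * A * G * Aᵀ * W) * y) 0 0) := by
  have hWt : Wᵀ = W := by simpa using hW.isHermitian.eq
  obtain ⟨b, hb⟩ : ∃ b, b = G * (Aᵀ * (W * y)) := ⟨_, rfl⟩
  obtain ⟨r, hr⟩ : ∃ r, r = y - A * b := ⟨_, rfl⟩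
  have h1 : Aᵀ * (W * r) = 0 := by
    have : Aᵀ * (W * (A * (G * (Aᵀ * (W * y))))) = ((Aᵀ * W * A) * G) * (Aᵀ * (W * y)) := by
      simp only [Matrix.mul_assoc]
    rw [hr, hb, Matrix.mul_sub, Matrix.mul_sub, this, hG, Matrix.one_mul, sub_self]
  have h2 : rᵀ * (W * A) = 0 := by
    have := congrArg Matrix.transpose h1
    simpa [Matrix.transpose_mul, hWt, Matrix.mul_assoc] using this
  have h3 : rᵀ * W * r = yᵀ * W * y - yᵀ * (W * A * G * Aᵀ * W) * y := by
    have e : rᵀ * W * r = rᵀ * W * y := by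
      conv_lhs => rw [show rᵀ * W * r = rᵀ * W * (y - A * b) by rw [← hr]]
      rw [Matrix.mul_sub, ← Matrix.mul_assoc, Matrix.mul_assoc rᵀ W A, h2, Matrix.zero_mul,
        sub_zero]
    rw [e, hr, hb]
    simp only [Matrix.transpose_sub, Matrix.transpose_mul, Matrix.transpose_transpose, hWt, hGt,
      Matrix.sub_mul, Matrix.mul_assoc]
  have h4 : ∀ β, (y - A * β)ᵀ * W * (y - A * β) =
      rᵀ * W * r + (A * (b - β))ᵀ * W * (A * (b - β)) := by
    intro β
    have : y - A * β = r + A * (b - β) := by rw [hr, Matrix.mul_sub]; abel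
    rw [this]
    have e1 : rᵀ * (W * (A * (b - β))) = 0 := by
      rw [← Matrix.mul_assoc W, ← Matrix.mul_assoc, h2, Matrix.zero_mul]
    have e2 : (A * (b - β))ᵀ * (W * r) = 0 := by
      rw [Matrix.transpose_mul, Matrix.mul_assoc, h1, Matrix.mul_zero]
    rw [Matrix.transpose_add]
    simp only [Matrix.add_mul, Matrix.mul_add, Matrix.mul_assoc rᵀ,
      Matrix.mul_assoc (A * (b - β))ᵀ, e1, e2]
    abel
  rw [← Matrix.sub_apply, ← h3]
  constructor
  · refine ⟨b, ?_⟩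
    simp only [← hr]
  · rintro _ ⟨β, rfl⟩
    simp only [h4 β, Matrix.add_apply]
    have := (hW.posSemidef.conjTranspose_mul_mul_same (A * (b - β))).diag_nonneg (i := 0)
    rw [Matrix.conjTranspose_eq_transpose_of_trivial] at this
    linarith

/-- first claim of Proposition 3: with weighted-orthonormal bases, the
minimum of the profiled GLS objective equals `yᵀ(Σ₃⊗Σ₂⊗Σ₁)⁻¹y − ‖(X₃ᵀ ⊗ U²ᵀΣ₂⁻¹ ⊗ U¹ᵀΣ₁⁻¹)y‖²`;
hence minimizing it over admissible bases is equivalent to maximizing the projected score. -/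
theorem stmt_6 (I₁ I₂ N p q P₁ P₂ : ℕ)
    (y : Matrix (Fin N × Fin I₂ × Fin I₁) (Fin 1) ℝ)
    (X : Matrix (Fin N) (Fin p) ℝ)
    (S₁ : Matrix (Fin I₁) (Fin I₁) ℝ) (S₂ : Matrix (Fin I₂) (Fin I₂) ℝ)
    (S₃ : Matrix (Fin N) (Fin N) ℝ)
    (hS₁ : S₁.PosDef) (hS₂ : S₂.PosDef) (hS₃ : S₃.PosDef)
    (hX : IsUnit (Xᵀ * S₃⁻¹ * X))
    (U₁ : Matrix (Fin I₁) (Fin P₁) ℝ) (U₂ : Matrix (Fin I₂) (Fin P₂) ℝ)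
    (hU₁ : U₁ᵀ * S₁⁻¹ * U₁ = 1) (hU₂ : U₂ᵀ * S₂⁻¹ * U₂ = 1)
    (X₃ : Matrix (Fin N) (Fin q) ℝ)
    (hX₃ : X₃ * X₃ᵀ = S₃⁻¹ * X * (Xᵀ * S₃⁻¹ * X)⁻¹ * Xᵀ * S₃⁻¹) :
    IsLeast (Set.range (glsObj X U₁ U₂ S₁ S₂ S₃ y))
        ((yᵀ * (S₃ ⊗ₖ (S₂ ⊗ₖ S₁))⁻¹ * y) 0 0 - projScore X₃ U₁ U₂ S₁ S₂ y) ∧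
      ∀ (V₁ : Matrix (Fin I₁) (Fin P₁) ℝ) (V₂ : Matrix (Fin I₂) (Fin P₂) ℝ),
        V₁ᵀ * S₁⁻¹ * V₁ = 1 → V₂ᵀ * S₂⁻¹ * V₂ = 1 →
        (((yᵀ * (S₃ ⊗ₖ (S₂ ⊗ₖ S₁))⁻¹ * y) 0 0 - projScore X₃ U₁ U₂ S₁ S₂ y
            ≤ (yᵀ * (S₃ ⊗ₖ (S₂ ⊗ₖ S₁))⁻¹ * y) 0 0 - projScore X₃ V₁ V₂ S₁ S₂ y)
          ↔ projScore X₃ V₁ V₂ S₁ S₂ y ≤ projScore X₃ U₁ U₂ S₁ S₂ y) := by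
  refine ⟨?_, fun V₁ V₂ _ _ => by constructor <;> intro h <;> linarith⟩
  have t : ∀ {n : ℕ} {S : Matrix (Fin n) (Fin n) ℝ}, S.PosDef → (S⁻¹)ᵀ = S⁻¹ := by
    intro n S h
    simpa using h.inv.isHermitian.eq
  have hWinv : (S₃ ⊗ₖ (S₂ ⊗ₖ S₁))⁻¹ = S₃⁻¹ ⊗ₖ (S₂⁻¹ ⊗ₖ S₁⁻¹) := by
    rw [Matrix.inv_kronecker, Matrix.inv_kronecker]
  have hW : ((S₃ ⊗ₖ (S₂ ⊗ₖ S₁))⁻¹).PosDef := (hS₃.kronecker (hS₂.kronecker hS₁)).inv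
  have key := gls_aux_s6 _ hW (X ⊗ₖ (U₂ ⊗ₖ U₁))
    ((Xᵀ * S₃⁻¹ * X)⁻¹ ⊗ₖ ((1 : Matrix (Fin P₂) (Fin P₂) ℝ) ⊗ₖ (1 : Matrix (Fin P₁) (Fin P₁) ℝ)))
    (by
      rw [hWinv]
      simp only [← Matrix.kroneckerMap_transpose, ← Matrix.mul_kronecker_mul, hU₁, hU₂]
      rw [Matrix.mul_nonsing_inv _ ((Matrix.isUnit_iff_isUnit_det _).1 hX)]
      simp)
    (by
      have : (Xᵀ * S₃⁻¹ * X)ᵀ = Xᵀ * S₃⁻¹ * X := by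
        simp only [Matrix.transpose_mul, Matrix.transpose_transpose, t hS₃, Matrix.mul_assoc]
      simp only [← Matrix.kroneckerMap_transpose, Matrix.transpose_nonsing_inv,
        Matrix.transpose_one, this]) y
  have hP : projScore X₃ U₁ U₂ S₁ S₂ y = (yᵀ * ((S₃ ⊗ₖ (S₂ ⊗ₖ S₁))⁻¹ * (X ⊗ₖ (U₂ ⊗ₖ U₁)) *
      ((Xᵀ * S₃⁻¹ * X)⁻¹ ⊗ₖ ((1 : Matrix (Fin P₂) (Fin P₂) ℝ) ⊗ₖ
        (1 : Matrix (Fin P₁) (Fin P₁) ℝ))) * (X ⊗ₖ (U₂ ⊗ₖ U₁))ᵀ *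
        (S₃ ⊗ₖ (S₂ ⊗ₖ S₁))⁻¹) * y) 0 0 := by
    unfold projScore
    have e : ∀ K : Matrix (Fin q × Fin P₂ × Fin P₁) (Fin N × Fin I₂ × Fin I₁) ℝ,
        (K * y)ᵀ * (K * y) = yᵀ * (Kᵀ * K) * y := by
      intro K
      simp only [Matrix.transpose_mul, Matrix.mul_assoc]
    rw [e, hWinv]
    simp only [← Matrix.kroneckerMap_transpose, ← Matrix.mul_kronecker_mul,
      Matrix.transpose_transpose, hX₃, Matrix.transpose_mul, t hS₁, t hS₂, Matrix.mul_one]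
    simp only [Matrix.mul_assoc]
  rw [hP]
  exact key
end
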